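/- For q odd, n even, and 1 ≤ β ≤ n−2, the double character sum satisfies S(β; n) = q^{β − n/2}·( −S(n−1−β; n) + (q−1)·Σ_{j=0}^{n−β−2} S(j; n) ). -/

import Mathlib

open Polynomial
open scoped Classical

/-- The quadratic residue symbol `(B/P)` for `P` a monic irreducible polynomial:
`0` if `P ∣ B`, `1` if `B` is a nonzero square modulo `P`, and `-1` otherwise. -/
noncomputable def legendreSymbol {F : Type*} [Field F] (B P : F[X]) : ℤ :=
  if P ∣ B then 0 else if ∃ C : F[X], P ∣ (C ^ 2 - B) then 1 else -1

/-- The double character sum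
`S(β; n) = Σ_{P monic irreducible, deg P = n} Σ_{B monic, deg B = β} (B/P)`. -/
noncomputable def doubleCharSum (F : Type*) [Field F] (β n : ℕ) : ℤ :=
  ∑ᶠ P ∈ {P : F[X] | P.Monic ∧ Irreducible P ∧ P.natDegree = n},
    ∑ᶠ B ∈ {B : F[X] | B.Monic ∧ B.natDegree = β}, legendreSymbol B P

/-- `π_q(n)`, the number of monic irreducible polynomials of degree `n`. -/
noncomputable def primeCount (F : Type*) [Field F] (n : ℕ) : ℕ :=
  {P : F[X] | P.Monic ∧ Irreducible P ∧ P.natDegree = n}.ncard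

section FiniteFieldSums

variable {F L : Type*} [Field F] [Fintype F] [Field L] [Fintype L] [Algebra F L]

/-- The fibres of a nonzero linear functional on a finite space have equal size. -/
lemma card_fiber_mul_card {W : Type*} [AddCommGroup W] [Module F W] [Fintype W]
    (g : W →ₗ[F] F) (hg : g ≠ 0) (c : F) :
    (∑ w : W, if g w = c then (1 : ℤ) else 0) * Fintype.card F = Fintype.card W := by
  have hsurj : Function.Surjective g := LinearMap.surjective hg
  have hconst : ∀ d : F, (∑ w : W, if g w = d then (1 : ℤ) else 0) =
      ∑ w : W, if g w = c then (1 : ℤ) else 0 := by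
    intro d
    obtain ⟨v, hv⟩ := hsurj (c - d)
    refine Fintype.sum_equiv (Equiv.addRight v) _ _ fun w => ?_
    have : g w + (c - d) = c ↔ g w = d := by
      constructor <;> intro h <;> linear_combination h
    simp [hv, this]
  have hswap : ∑ d : F, (∑ w : W, if g w = d then (1 : ℤ) else 0) = Fintype.card W := by
    rw [Finset.sum_comm]
    simp
  rw [← hswap, Finset.sum_congr rfl fun d _ => hconst d]
  simp [mul_comm]

/-- The sum of the quadratic character over a hyperplane determines the duality between its sums
over a subspace and over the annihilator of that subspace. -/
lemma sum_quadraticChar_mul_sum_submodule (hL : ringChar L ≠ 2) (l : L →ₗ[F] F)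
    (V W : Submodule F L) (hVW : ∀ x, x ∈ W ↔ ∀ y ∈ V, l (x * y) = 0) :
    (∑ x : L, if l x = 0 then quadraticChar L x else 0) * (∑ y : V, quadraticChar L y) *
      Fintype.card F =
      Fintype.card V * (Fintype.card F - 1) * ∑ x : W, quadraticChar L x := by
  have hfib : ∀ x : L, (∑ y : V, if l (x * y) = 0 then (1 : ℤ) else 0) * Fintype.card F =
      Fintype.card V + if x ∈ W then (Fintype.card V : ℤ) * (Fintype.card F - 1) else 0 := by
    intro x
    by_cases hx : x ∈ W
    · have h : ∀ y : V, l (x * y) = 0 := fun y => (hVW x).1 hx y y.2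
      simp only [h, hx, if_true, Finset.sum_const, Finset.card_univ, nsmul_eq_mul]
      ring
    · have hne : (l ∘ₗ LinearMap.mulLeft F x ∘ₗ V.subtype) ≠ 0 := by
        intro h0
        refine hx ((hVW x).2 fun y hy => ?_)
        simpa using LinearMap.congr_fun h0 ⟨y, hy⟩
      rw [if_neg hx, add_zero]
      exact card_fiber_mul_card _ hne 0
  have hinner : ∀ y : L, (∑ x : L, if l (x * y) = 0 then quadraticChar L x else 0) =
      (∑ x : L, if l x = 0 then quadraticChar L x else 0) * quadraticChar L y := by
    intro y
    by_cases hy : y = 0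
    · rw [hy, MulChar.map_zero, mul_zero]
      simpa only [mul_zero, map_zero, if_true] using quadraticChar_sum_zero hL
    · rw [Finset.sum_mul]
      refine Fintype.sum_equiv (Equiv.mulRight₀ y hy) _ _ fun x => ?_
      have := quadraticChar_sq_one hy
      by_cases h : l (x * y) = 0
      · simp only [h, Equiv.mulRight₀_apply, if_true, map_mul]
        linear_combination -(quadraticChar L x) * this
      · simp [h]
  rw [Finset.mul_sum, ← Finset.sum_congr rfl fun (y : V) _ => hinner y, Finset.sum_comm]
  have hx : ∀ x : L, (∑ y : V, if l (x * y) = 0 then quadraticChar L x else 0) *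
      Fintype.card F = Fintype.card V * quadraticChar L x +
        Fintype.card V * (Fintype.card F - 1) * if x ∈ W then quadraticChar L x else 0 := by
    intro x
    have : (∑ y : V, if l (x * y) = 0 then quadraticChar L x else 0) =
        quadraticChar L x * ∑ y : V, if l (x * y) = 0 then (1 : ℤ) else 0 := by
      rw [Finset.mul_sum]
      simp
    rw [this, mul_assoc, hfib]
    split_ifs <;> ring
  rw [Finset.sum_mul, Finset.sum_congr rfl fun x _ => hx x, Finset.sum_add_distrib,
    ← Finset.mul_sum, ← Finset.mul_sum, quadraticChar_sum_zero hL, mul_zero, zero_add,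
    ← Finset.sum_filter]
  congr 1
  exact Finset.sum_subtype _ (by simp) _

/-- If the quadratic form `y ↦ l (y ^ 2)` has a Lagrangian subspace `W`, then it is hyperbolic,
which evaluates the sum of the quadratic character over the kernel of `l`. -/
lemma sum_quadraticChar_ker (hL : ringChar L ≠ 2) (l : L →ₗ[F] F) (hl : l ≠ 0)
    (W : Submodule F L) (hW : ∀ x, x ∈ W ↔ ∀ y ∈ W, l (x * y) = 0) :
    (∑ x : L, if l x = 0 then quadraticChar L x else 0) * Fintype.card F =
      Fintype.card W * (Fintype.card F - 1) := by
  have h2 : (2 : L) ≠ 0 := Ring.two_ne_zero hL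
  have h2F : (2 : F) ≠ 0 := by
    intro h
    apply h2
    rw [← map_ofNat (algebraMap F L) 2, h, map_zero]
  have hfib : ∀ x : L,
      (∑ w : W, if l ((x + w) ^ 2) = 0 then (1 : ℤ) else 0) * Fintype.card F =
      Fintype.card W + if x ∈ W then (Fintype.card W : ℤ) * (Fintype.card F - 1) else 0 := by
    intro x
    have hexp : ∀ w : W, l ((x + w) ^ 2) = l (x * x) + 2 * l (x * w) := by
      intro w
      have e : (x + (w : L)) ^ 2 = x * x + (2 : F) • (x * w) + w * w := by
        rw [Algebra.smul_def, map_ofNat]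
        ring
      rw [e, map_add, map_add, map_smul, (hW w).1 w.2 w w.2]
      simp
    by_cases hx : x ∈ W
    · have h : ∀ w : W, l ((x + w) ^ 2) = 0 := fun w => by
        rw [hexp, (hW x).1 hx x hx, (hW x).1 hx w w.2]
        simp
      simp only [h, hx, if_true, Finset.sum_const, Finset.card_univ, nsmul_eq_mul]
      ring
    · have hne : (l ∘ₗ LinearMap.mulLeft F x ∘ₗ W.subtype) ≠ 0 := by
        intro h0
        refine hx ((hW x).2 fun y hy => ?_)
        simpa using LinearMap.congr_fun h0 ⟨y, hy⟩
      have hiff : ∀ w : W, l ((x + w) ^ 2) = 0 ↔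
          (l ∘ₗ LinearMap.mulLeft F x ∘ₗ W.subtype) w = -l (x * x) / 2 := by
        intro w
        rw [hexp, eq_div_iff h2F]
        simp only [LinearMap.comp_apply, LinearMap.mulLeft_apply, Submodule.subtype_apply]
        constructor <;> intro h <;> linear_combination h
      simp only [hiff, hx, if_false, add_zero]
      exact card_fiber_mul_card _ hne _
  have hsq : (∑ y : L, if l (y ^ 2) = 0 then (1 : ℤ) else 0) =
      (∑ x : L, if l x = 0 then quadraticChar L x else 0) +
        ∑ x : L, if l x = 0 then (1 : ℤ) else 0 := by
    have hcnt : ∀ x : L, (∑ y : L, if y ^ 2 = x then (1 : ℤ) else 0) =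
        quadraticChar L x + 1 := by
      intro x
      rw [← quadraticChar_card_sqrts hL x]
      simp
    calc (∑ y : L, if l (y ^ 2) = 0 then (1 : ℤ) else 0)
        = ∑ y : L, ∑ x : L, if y ^ 2 = x then (if l x = 0 then (1 : ℤ) else 0) else 0 := by
          simp
      _ = ∑ x : L, if l x = 0 then (∑ y : L, if y ^ 2 = x then (1 : ℤ) else 0) else 0 := by
          rw [Finset.sum_comm]
          refine Finset.sum_congr rfl fun x _ => ?_
          by_cases h : l x = 0 <;> simp [h]
      _ = _ := by
          rw [← Finset.sum_add_distrib]
          refine Finset.sum_congr rfl fun x _ => ?_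
          rw [hcnt]
          split_ifs <;> simp
  have havg : (Fintype.card W : ℤ) * (∑ y : L, if l (y ^ 2) = 0 then (1 : ℤ) else 0) =
      ∑ x : L, ∑ w : W, if l ((x + w) ^ 2) = 0 then (1 : ℤ) else 0 := by
    have hshift : ∀ w : W, (∑ x : L, if l ((x + w) ^ 2) = 0 then (1 : ℤ) else 0) =
        ∑ y : L, if l (y ^ 2) = 0 then (1 : ℤ) else 0 := fun w =>
      Fintype.sum_equiv (Equiv.addRight (w : L)) _ _ fun x => rfl
    rw [Finset.sum_comm, Finset.sum_congr rfl fun w _ => hshift w, Finset.sum_const, nsmul_eq_mul,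
      Finset.card_univ]
  have htot : (∑ x : L, ∑ w : W, if l ((x + w) ^ 2) = 0 then (1 : ℤ) else 0) *
      Fintype.card F = Fintype.card L * Fintype.card W +
        Fintype.card W * (Fintype.card W * (Fintype.card F - 1)) := by
    rw [Finset.sum_mul, Finset.sum_congr rfl fun x _ => hfib x, Finset.sum_add_distrib,
      ← Finset.sum_filter, Finset.sum_const, Finset.sum_const, ← Fintype.card_subtype,
      Finset.card_univ]
    simp
  have hker := card_fiber_mul_card l hl 0
  have hW0 : (Fintype.card W : ℤ) ≠ 0 := by exact_mod_cast Fintype.card_ne_zero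
  rw [hsq] at havg
  rw [← havg] at htot
  apply mul_left_cancel₀ hW0
  linear_combination htot - (Fintype.card W : ℤ) * hker

/-- Scalars from `F` are squares in an extension whose cardinality is an even power of that
of `F`. -/
lemma quadraticChar_algebraMap_of_card (hF : Odd (Fintype.card F)) (hL : ringChar L ≠ 2) (m : ℕ)
    (hcard : Fintype.card L = Fintype.card F ^ (2 * m)) (c : F) (hc : c ≠ 0) :
    quadraticChar L (algebraMap F L c) = 1 := by
  have hc' : algebraMap F L c ≠ 0 := by simpa using hc
  rw [quadraticChar_one_iff_isSquare hc', FiniteField.isSquare_iff hL hc']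
  set q := Fintype.card F
  have hq1 : 1 ≤ q := hF.pos
  obtain ⟨a, ha⟩ : q - 1 ∣ q ^ m - 1 := by
    simpa using Nat.sub_dvd_pow_sub_pow q 1 m
  obtain ⟨b, hb⟩ := hF.pow (n := m)
  have hdiv : Fintype.card L / 2 = (q - 1) * (a * (b + 1)) := by
    have h1 : q ^ (2 * m) = 2 * ((q - 1) * (a * (b + 1))) + 1 := by
      rw [← mul_assoc (q - 1), ← ha, mul_comm 2 m, pow_mul, hb]
      simp only [Nat.add_sub_cancel]
      ring
    rw [hcard, h1]
    omega
  rw [hdiv, pow_mul, ← map_pow, FiniteField.pow_card_sub_one_eq_one c hc, map_one, one_pow]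

end FiniteFieldSums

section Residues

variable {F : Type*} [Field F] {P : F[X]}

/-- The classes modulo `P` of the polynomials of degree less than `k`. -/
noncomputable def classesDegreeLT (P : F[X]) (k : ℕ) : Submodule F (AdjoinRoot P) :=
  LinearMap.range ((AdjoinRoot.mkₐ P).toLinearMap ∘ₗ (degreeLT F k).subtype)

lemma mem_classesDegreeLT {k : ℕ} {x : AdjoinRoot P} :
    x ∈ classesDegreeLT P k ↔ ∃ p : F[X], p.degree < k ∧ AdjoinRoot.mk P p = x := by
  simp only [classesDegreeLT, LinearMap.mem_range, Subtype.exists, ← mem_degreeLT]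
  exact ⟨fun ⟨p, hp, h⟩ => ⟨p, hp, h⟩, fun ⟨p, hp, h⟩ => ⟨p, hp, h⟩⟩

lemma injective_mk_degreeLT (hP : P ≠ 0) {k : ℕ} (hk : k ≤ P.natDegree) :
    Function.Injective ((AdjoinRoot.mkₐ P).toLinearMap ∘ₗ (degreeLT F k).subtype) := by
  rw [← LinearMap.ker_eq_bot, LinearMap.ker_eq_bot']
  rintro ⟨p, hp⟩ h
  have h' : AdjoinRoot.mk P p = 0 := h
  rw [AdjoinRoot.mk_eq_zero] at h'
  refine Subtype.ext (eq_zero_of_dvd_of_degree_lt h' ?_)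
  rw [degree_eq_natDegree hP]
  exact (mem_degreeLT.1 hp).trans_le (by exact_mod_cast hk)

/-- The coefficient of `X ^ (deg P - 1)` in the reduced representative modulo `P`. -/
noncomputable def topCoeff (hP : P.Monic) : AdjoinRoot P →ₗ[F] F :=
  lcoeff F (P.natDegree - 1) ∘ₗ AdjoinRoot.modByMonicHom hP

lemma topCoeff_mk (hP : P.Monic) {p : F[X]} (hp : p.degree < P.natDegree) :
    topCoeff hP (AdjoinRoot.mk P p) = p.coeff (P.natDegree - 1) := by
  simp only [topCoeff, LinearMap.comp_apply, AdjoinRoot.modByMonicHom_mk, lcoeff_apply]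
  rw [(modByMonic_eq_self_iff hP).2 (by rwa [degree_eq_natDegree hP.ne_zero])]

lemma mem_classesDegreeLT_sub_iff (hP : P.Monic) {k : ℕ} (hk : k ≤ P.natDegree)
    (x : AdjoinRoot P) :
    x ∈ classesDegreeLT P (P.natDegree - k) ↔
      ∀ y ∈ classesDegreeLT P k, topCoeff hP (x * y) = 0 := by
  constructor
  · intro hx y hy
    obtain ⟨p, hp, rfl⟩ := mem_classesDegreeLT.1 hx
    obtain ⟨r, hr, rfl⟩ := mem_classesDegreeLT.1 hy
    by_cases hp0 : p = 0
    · simp [hp0]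
    by_cases hr0 : r = 0
    · simp [hr0]
    rw [degree_eq_natDegree hp0, Nat.cast_lt] at hp
    rw [degree_eq_natDegree hr0, Nat.cast_lt] at hr
    have hlt : (p * r).natDegree < P.natDegree - 1 := by
      rw [natDegree_mul hp0 hr0]
      omega
    rw [← map_mul, topCoeff_mk, coeff_eq_zero_of_natDegree_lt hlt]
    rw [degree_eq_natDegree (mul_ne_zero hp0 hr0), Nat.cast_lt]
    omega
  · intro h
    obtain ⟨p', rfl⟩ := AdjoinRoot.mk_surjective x
    obtain ⟨p, hp, hpp⟩ : ∃ p : F[X], p.degree < P.natDegree ∧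
        AdjoinRoot.mk P p = AdjoinRoot.mk P p' :=
      ⟨p' %ₘ P, by simpa [degree_eq_natDegree hP.ne_zero] using degree_modByMonic_lt p' hP, by
        simpa using AdjoinRoot.mk_leftInverse hP (AdjoinRoot.mk P p')⟩
    rw [← hpp] at h ⊢
    by_contra hx
    have hp0 : p ≠ 0 := by
      rintro rfl
      simp at hx
    rw [degree_eq_natDegree hp0, Nat.cast_lt] at hp
    have hle : P.natDegree - k ≤ p.natDegree := by
      by_contra! hlt
      refine hx (mem_classesDegreeLT.2 ⟨p, ?_, rfl⟩)
      rwa [degree_eq_natDegree hp0, Nat.cast_lt]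
    have hX : AdjoinRoot.mk P (X ^ (P.natDegree - 1 - p.natDegree)) ∈ classesDegreeLT P k := by
      refine mem_classesDegreeLT.2 ⟨_, ?_, rfl⟩
      rw [degree_X_pow, Nat.cast_lt]
      omega
    have hcoeff := h _ hX
    have hne : p * X ^ (P.natDegree - 1 - p.natDegree) ≠ 0 :=
      mul_ne_zero hp0 (pow_ne_zero _ X_ne_zero)
    have hdeg : (p * X ^ (P.natDegree - 1 - p.natDegree)).natDegree = P.natDegree - 1 := by
      rw [natDegree_mul_X_pow _ hp0]
      omega
    rw [← map_mul, topCoeff_mk] at hcoeff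
    · exact leadingCoeff_ne_zero.2 hne (by rwa [leadingCoeff, hdeg])
    · rw [degree_eq_natDegree hne, hdeg, Nat.cast_lt]
      omega

lemma topCoeff_ne_zero (hP : P.Monic) (hdeg : 0 < P.natDegree) : topCoeff hP ≠ 0 := by
  intro h
  have h1 := LinearMap.congr_fun h (AdjoinRoot.mk P (X ^ (P.natDegree - 1)))
  rw [topCoeff_mk hP (by rw [degree_X_pow, Nat.cast_lt]; omega)] at h1
  simp at h1

lemma legendreSymbol_eq_quadraticChar [Fact (Irreducible P)] [Fintype (AdjoinRoot P)] (B : F[X]) :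
    legendreSymbol B P = quadraticChar (AdjoinRoot P) (AdjoinRoot.mk P B) := by
  have hsq : IsSquare (AdjoinRoot.mk P B) ↔ ∃ C : F[X], P ∣ C ^ 2 - B := by
    constructor
    · rintro ⟨y, hy⟩
      obtain ⟨C, rfl⟩ := AdjoinRoot.mk_surjective y
      refine ⟨C, ?_⟩
      rw [← AdjoinRoot.mk_eq_mk, hy, map_pow, sq]
    · rintro ⟨C, hC⟩
      rw [← AdjoinRoot.mk_eq_mk] at hC
      exact ⟨AdjoinRoot.mk P C, by rw [← hC, map_pow, sq]⟩
  simp only [legendreSymbol, quadraticChar_apply, quadraticCharFun, hsq, AdjoinRoot.mk_eq_zero]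

end Residues

section PolynomialSums

variable {F : Type*} [Field F] [Fintype F]

noncomputable instance fintypeDegreeLT (k : ℕ) : Fintype (degreeLT F k) :=
  Fintype.ofEquiv _ (degreeLTEquiv F k).symm.toEquiv

lemma card_degreeLT (k : ℕ) : Fintype.card (degreeLT F k) = Fintype.card F ^ k := by
  rw [Fintype.card_congr (degreeLTEquiv F k).toEquiv, Fintype.card_fun, Fintype.card_fin]

lemma finsum_monic_eq_sum_degreeLT (f : F[X] → ℤ) (k : ℕ) :
    ∑ᶠ B ∈ {B : F[X] | B.Monic ∧ B.natDegree = k}, f B =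
      ∑ r : degreeLT F k, f (X ^ k + (r : F[X])) := by
  rw [← finsum_set_coe_eq_finsum_mem, ← finsum_eq_sum_of_fintype]
  exact (finsum_comp_equiv (monicEquivDegreeLT (R := F) k).symm
    (f := fun B : {p : F[X] // p.Monic ∧ p.natDegree = k} => f B)).symm

/-- A function invariant under nonzero scalars can be summed over polynomials of bounded degree
by summing over monic polynomials. -/
lemma sum_degreeLT_succ (f : F[X] → ℤ) (hf : ∀ (c : F) (p : F[X]), c ≠ 0 → f (C c * p) = f p)
    (k : ℕ) :
    ∑ p : degreeLT F (k + 1), f p = ∑ p : degreeLT F k, f p +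
      (Fintype.card F - 1) * ∑ᶠ B ∈ {B : F[X] | B.Monic ∧ B.natDegree = k}, f B := by
  have hmem : ∀ x : F × degreeLT F k, C x.1 * X ^ k + (x.2 : F[X]) ∈ degreeLT F (k + 1) := by
    intro x
    refine Submodule.add_mem _ ?_ (degreeLT_mono k.le_succ x.2.2)
    rw [mem_degreeLT]
    exact (degree_C_mul_X_pow_le k x.1).trans_lt (by exact_mod_cast k.lt_succ_self)
  have hcoeff : ∀ r : degreeLT F k, (r : F[X]).coeff k = 0 := fun r =>
    coeff_eq_zero_of_degree_lt (mem_degreeLT.1 r.2)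
  have hbij : Function.Bijective
      (fun x : F × degreeLT F k => (⟨C x.1 * X ^ k + (x.2 : F[X]), hmem x⟩ : degreeLT F (k + 1))) := by
    rw [Fintype.bijective_iff_injective_and_card]
    refine ⟨?_, ?_⟩
    · rintro ⟨c, r⟩ ⟨d, s⟩ h
      have h' : C c * X ^ k + (r : F[X]) = C d * X ^ k + (s : F[X]) :=
        congrArg Subtype.val h
      have hc : c = d := by
        have := congrArg (fun p : F[X] => p.coeff k) h'
        simpa [hcoeff] using this
      subst hc
      exact Prod.ext rfl (Subtype.ext (add_left_cancel h'))
    · rw [Fintype.card_prod, card_degreeLT, card_degreeLT, pow_succ']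
  rw [finsum_monic_eq_sum_degreeLT, ← Fintype.sum_bijective _ hbij
    (fun x => f (C x.1 * X ^ k + (x.2 : F[X]))) _ fun x => rfl, Fintype.sum_prod_type,
    ← Finset.add_sum_erase _ _ (Finset.mem_univ (0 : F))]
  have hmonic : ∀ c ∈ Finset.univ.erase (0 : F),
      ∑ r : degreeLT F k, f (C c * X ^ k + (r : F[X])) =
        ∑ r : degreeLT F k, f (X ^ k + (r : F[X])) := by
    intro c hc
    have hc0 : c ≠ 0 := Finset.ne_of_mem_erase hc
    symm
    refine Fintype.sum_equiv (LinearEquiv.smulOfNeZero F (degreeLT F k) c hc0).toEquiv _ _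
      fun r => ?_
    rw [← hf c _ hc0]
    simp [mul_add, smul_eq_C_mul]
  rw [Finset.sum_congr rfl hmonic, Finset.sum_const, Finset.card_erase_of_mem (Finset.mem_univ _),
    Finset.card_univ, nsmul_eq_mul, Nat.cast_sub Fintype.card_pos]
  simp

lemma sum_degreeLT_eq (f : F[X] → ℤ) (h0 : f 0 = 0)
    (hf : ∀ (c : F) (p : F[X]), c ≠ 0 → f (C c * p) = f p) (k : ℕ) :
    ∑ p : degreeLT F k, f p = (Fintype.card F - 1) *
      ∑ j ∈ Finset.range k, ∑ᶠ B ∈ {B : F[X] | B.Monic ∧ B.natDegree = j}, f B := by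
  induction k with
  | zero =>
    have : ∀ p : degreeLT F 0, f p = 0 := fun p => by
      have hp : (p : F[X]) = 0 := by simpa using mem_degreeLT.1 p.2
      rw [hp, h0]
    simp [this]
  | succ k ih => rw [sum_degreeLT_succ f hf, ih, Finset.sum_range_succ, mul_add]

variable {P : F[X]}

/-- The functional equation of `L(u, χ_P)` for an irreducible `P` of even degree, expressed through
character sums over polynomials of bounded degree. -/
lemma sum_legendreSymbol_degreeLT_duality (hq : Odd (Fintype.card F)) (hP : P.Monic)
    (hirr : Irreducible P) (m : ℕ) (hdeg : P.natDegree = 2 * m) {k : ℕ} (hk : k ≤ 2 * m) :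
    (Fintype.card F : ℤ) ^ m * ∑ j ∈ Finset.range k,
        ∑ᶠ B ∈ {B : F[X] | B.Monic ∧ B.natDegree = j}, legendreSymbol B P =
      (Fintype.card F : ℤ) ^ k * ∑ j ∈ Finset.range (2 * m - k),
        ∑ᶠ B ∈ {B : F[X] | B.Monic ∧ B.natDegree = j}, legendreSymbol B P := by
  have : Fact (Irreducible P) := ⟨hirr⟩
  have : Module.Finite F (AdjoinRoot P) := (AdjoinRoot.powerBasis hP.ne_zero).finite
  have : Finite (AdjoinRoot P) := Module.finite_of_finite F
  let _ : Fintype (AdjoinRoot P) := Fintype.ofFinite _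
  have hcardL : Fintype.card (AdjoinRoot P) = Fintype.card F ^ (2 * m) := by
    rw [Module.card_eq_pow_finrank (K := F), (AdjoinRoot.powerBasis hP.ne_zero).finrank,
      AdjoinRoot.powerBasis_dim, hdeg]
  have hL : ringChar (AdjoinRoot P) ≠ 2 := by
    rw [Ne, FiniteField.even_card_iff_char_two, hcardL, ← Nat.even_iff, Nat.not_even_iff_odd]
    exact hq.pow
  have hcardV : ∀ k ≤ 2 * m, Fintype.card (classesDegreeLT P k) = Fintype.card F ^ k := by
    intro k hk
    rw [← card_degreeLT, eq_comm]
    exact Fintype.card_congr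
      (LinearEquiv.ofInjective _ (injective_mk_degreeLT hP.ne_zero (hdeg ▸ hk))).toEquiv
  have hsum : ∀ k ≤ 2 * m, ∑ x : classesDegreeLT P k, quadraticChar (AdjoinRoot P) x =
      (Fintype.card F - 1) * ∑ j ∈ Finset.range k,
        ∑ᶠ B ∈ {B : F[X] | B.Monic ∧ B.natDegree = j}, legendreSymbol B P := by
    intro k hk
    rw [← sum_degreeLT_eq (fun B => legendreSymbol B P)]
    · let e : degreeLT F k ≃ classesDegreeLT P k :=
        (LinearEquiv.ofInjective _ (injective_mk_degreeLT hP.ne_zero (hdeg ▸ hk))).toEquiv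
      exact (Fintype.sum_equiv e _ _ fun p => legendreSymbol_eq_quadraticChar _).symm
    · simp [legendreSymbol]
    · intro c p hc
      have hc1 := quadraticChar_algebraMap_of_card hq hL m hcardL c hc
      rw [AdjoinRoot.algebraMap_eq] at hc1
      rw [legendreSymbol_eq_quadraticChar, legendreSymbol_eq_quadraticChar, map_mul, map_mul,
        AdjoinRoot.mk_C, hc1, one_mul]
  have hm : 0 < m := by
    have := hirr.natDegree_pos
    omega
  have hker := sum_quadraticChar_ker hL (topCoeff hP) (topCoeff_ne_zero hP hirr.natDegree_pos)
    (classesDegreeLT P m) (by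
      have := mem_classesDegreeLT_sub_iff hP (k := m) (by omega)
      rwa [show P.natDegree - m = m by omega] at this)
  have hdual := sum_quadraticChar_mul_sum_submodule hL (topCoeff hP) (classesDegreeLT P k)
    (classesDegreeLT P (2 * m - k)) (by
      rw [← hdeg]
      exact mem_classesDegreeLT_sub_iff hP (by omega))
  rw [hsum k hk, hsum _ (Nat.sub_le _ _), hcardV k hk] at hdual
  rw [hcardV m (by omega)] at hker
  have hq1 : (Fintype.card F : ℤ) - 1 ≠ 0 := by
    have : 1 < Fintype.card F := Fintype.one_lt_card
    omega
  apply mul_left_cancel₀ (pow_ne_zero 2 hq1)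
  push_cast at hdual hker
  linear_combination hdual - (((Fintype.card F : ℤ) - 1) * ∑ j ∈ Finset.range k,
    ∑ᶠ B ∈ {B : F[X] | B.Monic ∧ B.natDegree = j}, legendreSymbol B P) * hker

lemma finite_monic_natDegree_eq (n : ℕ) : {P : F[X] | P.Monic ∧ P.natDegree = n}.Finite :=
  Set.finite_coe_iff.1 (Finite.of_equiv _ (monicEquivDegreeLT (R := F) n).symm)

end PolynomialSums

/-- For `q` odd, `n` even, and `1 ≤ β ≤ n-2`, the duality
`S(β; n) = q^{β - n/2} (−S(n−1−β; n) + (q−1) Σ_{j=0}^{n−β−2} S(j; n))` holds. -/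
theorem doubleCharSum_duality_even (F : Type*) [Field F] [Fintype F]
    (hq : Odd (Fintype.card F)) (n : ℕ) (heven : Even n) (β : ℕ)
    (hβ1 : 1 ≤ β) (hβ2 : β ≤ n - 2) :
    ((doubleCharSum F β n : ℤ) : ℚ) =
      (Fintype.card F : ℚ) ^ ((β : ℤ) - (n / 2 : ℕ)) *
        (-((doubleCharSum F (n - 1 - β) n : ℤ) : ℚ) +
          ((Fintype.card F : ℚ) - 1) *
            ∑ j ∈ Finset.range (n - β - 1), ((doubleCharSum F j n : ℤ) : ℚ)) := by
  obtain ⟨m, hm⟩ := heven.two_dvd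
  have hm2 : n / 2 = m := by omega
  have hfin : {P : F[X] | P.Monic ∧ Irreducible P ∧ P.natDegree = n}.Finite :=
    (finite_monic_natDegree_eq n).subset fun P hP => ⟨hP.1, hP.2.2⟩
  have hS : ∀ j, doubleCharSum F j n = ∑ P ∈ hfin.toFinset,
      ∑ᶠ B ∈ {B : F[X] | B.Monic ∧ B.natDegree = j}, legendreSymbol B P := fun j =>
    finsum_mem_eq_finite_toFinset_sum _ hfin
  have hdual : ∀ k ≤ n, (Fintype.card F : ℚ) ^ m *
        ∑ j ∈ Finset.range k, ((doubleCharSum F j n : ℤ) : ℚ) =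
      (Fintype.card F : ℚ) ^ k *
        ∑ j ∈ Finset.range (n - k), ((doubleCharSum F j n : ℤ) : ℚ) := by
    intro k hk
    simp only [hS]
    norm_cast
    rw [Finset.sum_comm, Finset.sum_comm (s := Finset.range (n - k)), Finset.mul_sum,
      Finset.mul_sum]
    refine Finset.sum_congr rfl fun P hP => ?_
    obtain ⟨hmon, hirr, hdeg⟩ := hfin.mem_toFinset.1 hP
    subst hm
    exact_mod_cast sum_legendreSymbol_degreeLT_duality hq hmon hirr m hdeg hk
  have hq0 : (Fintype.card F : ℚ) ≠ 0 := by exact_mod_cast Fintype.card_ne_zero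
  have h1 := hdual β (by omega)
  have h2 := hdual (β + 1) (by omega)
  rw [show n - β = n - β - 1 + 1 by omega, Finset.sum_range_succ,
    show n - β - 1 = n - 1 - β by omega] at h1
  rw [Finset.sum_range_succ, show n - (β + 1) = n - 1 - β by omega, pow_succ] at h2
  rw [hm2, zpow_sub₀ hq0, zpow_natCast, zpow_natCast, div_mul_eq_mul_div,
    eq_div_iff (pow_ne_zero _ hq0), show n - β - 1 = n - 1 - β by omega]
  linear_combination h2 - h1
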